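/- arXiv:2310.00470 — 2 statements merged into one kernel-verified Lean document; each statement's English description precedes it below -/
import Mathlib

section
/- Let G be a group and ν : G → ℝ a nonnegative, symmetric, subadditive function (ν(gh) ≤ ν(g) + ν(h), ν(g⁻¹) = ν(g), ν(g) ≥ 0 for all g, h ∈ G). Suppose φ ∈ G, N ≥ 1 is an integer and η > 0 are such that ν(φ^{Nℓ}) > η for every integer ℓ ≥ 1. Then liminf_{k→∞} ν(φ^k) ≥ η/2; in particular, the set of k ∈ ℕ with ν(φ^k) < η/2 is finite. -/
/-- If a symmetric subadditive function exceeds `η` at all the powers `φ ^ (N * ℓ)` with `ℓ ≥ 1`,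
then two distinct exponents congruent modulo `N` cannot both have value below `η / 2`. -/
theorem half_le_of_modEq_of_lt {G : Type*} [Group G] {ν : G → ℝ}
    (h_sub : ∀ g h : G, ν (g * h) ≤ ν g + ν h) (h_symm : ∀ g : G, ν g⁻¹ = ν g)
    {φ : G} {N : ℕ} {η : ℝ} (hprog : ∀ ℓ : ℕ, 1 ≤ ℓ → η < ν (φ ^ (N * ℓ)))
    {a b : ℕ} (hab : a < b) (hmod : a ≡ b [MOD N]) (ha : ν (φ ^ a) < η / 2) :
    η / 2 ≤ ν (φ ^ b) := by
  obtain ⟨ℓ, hℓ⟩ := (Nat.modEq_iff_dvd' hab.le).1 hmod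
  have hpos : 1 ≤ ℓ := by
    rcases Nat.eq_zero_or_pos ℓ with rfl | h
    · rw [mul_zero] at hℓ
      omega
    · exact h
  have hlarge := hprog ℓ hpos
  rw [← hℓ, pow_sub φ hab.le] at hlarge
  linarith [h_sub (φ ^ b) (φ ^ a)⁻¹, h_symm (φ ^ a)]

/-- Let `G` be a group and `ν : G → ℝ` a nonnegative, symmetric, subadditive
function. Suppose `φ ∈ G`, `N ≥ 1` and `η > 0` are such that `ν (φ ^ (N * ℓ)) > η`
for every `ℓ ≥ 1`. Then `liminf_{k → ∞} ν (φ ^ k) ≥ η / 2`; in particular the set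
of `k` with `ν (φ ^ k) < η / 2` is finite. -/
theorem liminf_ge_half_of_progression_bound
    {G : Type*} [Group G] (ν : G → ℝ)
    (h_sub : ∀ g h : G, ν (g * h) ≤ ν g + ν h)
    (h_symm : ∀ g : G, ν g⁻¹ = ν g)
    (h_nonneg : ∀ g : G, 0 ≤ ν g)
    (φ : G) (N : ℕ) (hN : 1 ≤ N) (η : ℝ) (hη : 0 < η)
    (hprog : ∀ ℓ : ℕ, 1 ≤ ℓ → η < ν (φ ^ (N * ℓ))) :
    ((η / 2 : ℝ) : EReal) ≤
      Filter.liminf (fun k : ℕ => ((ν (φ ^ k) : ℝ) : EReal)) Filter.atTop ∧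
    {k : ℕ | ν (φ ^ k) < η / 2}.Finite := by
  have hfin : {k : ℕ | ν (φ ^ k) < η / 2}.Finite := by
    refine Set.Finite.of_injOn (f := (· % N)) (t := Set.Iio N)
      (fun k _ => Nat.mod_lt k hN) ?_ (Set.finite_Iio N)
    intro a ha b hb hab
    rcases lt_trichotomy a b with h | h | h
    · exact absurd hb (half_le_of_modEq_of_lt h_sub h_symm hprog h hab ha).not_gt
    · exact h
    · exact absurd ha (half_le_of_modEq_of_lt h_sub h_symm hprog h hab.symm hb).not_gt
  refine ⟨Filter.le_liminf_of_le (by isBoundedDefault) ?_, hfin⟩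
  have hev : ∀ᶠ k in Filter.atTop, k ∉ {k : ℕ | ν (φ ^ k) < η / 2} :=
    Nat.cofinite_eq_atTop ▸ hfin.eventually_cofinite_notMem
  filter_upwards [hev] with k hk
  exact EReal.coe_le_coe_iff.2 (not_lt.1 hk)
end

section
/- Let G be a group and ν : G → ℝ a nonnegative, symmetric, subadditive function. Then for every φ ∈ G and every integer N ≥ 1, liminf_{ℓ→∞} ν(φ^{Nℓ}) ≤ 2 · liminf_{k→∞} ν(φ^k), where the liminf is taken over positive integers ℓ, respectively k. -/
/-- If a property holds for infinitely many naturals, then it holds for infinitely many naturals in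
some residue class modulo `N`. -/
theorem exists_frequently_and_mod_eq {p : ℕ → Prop} (hp : ∃ᶠ k in Filter.atTop, p k)
    {N : ℕ} (hN : 0 < N) : ∃ r, ∃ᶠ k in Filter.atTop, p k ∧ k % N = r := by
  by_contra! h
  have h_all := (Filter.eventually_all_finset (Finset.range N)).2 fun r _ => h r
  refine hp (h_all.mono fun k hk hpk => ?_)
  exact hk (k % N) (Finset.mem_range.2 (Nat.mod_lt k hN)) hpk rfl

/-- For a symmetric subadditive function, if infinitely many powers of `φ` have value less than `c`,
then infinitely many powers of `φ ^ N` have value less than `c + c`. -/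
theorem frequently_pow_mul_lt {G : Type*} [Group G] {ν : G → ℝ}
    (h_sub : ∀ g h : G, ν (g * h) ≤ ν g + ν h) (h_symm : ∀ g : G, ν g⁻¹ = ν g)
    {φ : G} {N : ℕ} (hN : 0 < N) {c : ℝ} (hc : ∃ᶠ k in Filter.atTop, ν (φ ^ k) < c) :
    ∃ᶠ l in Filter.atTop, ν (φ ^ (N * l)) < c + c := by
  obtain ⟨r, hr⟩ := exists_frequently_and_mod_eq hc hN
  obtain ⟨m, hm, hmr⟩ := hr.exists
  rw [Filter.frequently_atTop] at hr ⊢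
  intro a
  obtain ⟨k, hk, hkc, hkr⟩ := hr (m + N * a)
  have hmk : m ≤ k := le_trans (Nat.le_add_right _ _) hk
  obtain ⟨l, hl⟩ : N ∣ k - m := (Nat.modEq_iff_dvd' hmk).1 (hmr.trans hkr.symm)
  refine ⟨l, Nat.le_of_mul_le_mul_left (by omega) hN, ?_⟩
  rw [← hl, pow_sub φ hmk]
  calc ν (φ ^ k * (φ ^ m)⁻¹) ≤ ν (φ ^ k) + ν (φ ^ m)⁻¹ := h_sub _ _
    _ < c + c := by rw [h_symm]; exact add_lt_add hkc hm

/-- Let `G` be a group and `ν : G → ℝ` a nonnegative, symmetric, subadditive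
function. Then for every `φ ∈ G` and integer `N ≥ 1`,
`liminf_{ℓ → ∞} ν (φ ^ (N * ℓ)) ≤ 2 * liminf_{k → ∞} ν (φ ^ k)`. -/
theorem liminf_pow_le_two_mul_liminf
    {G : Type*} [Group G] (ν : G → ℝ)
    (h_sub : ∀ g h : G, ν (g * h) ≤ ν g + ν h)
    (h_symm : ∀ g : G, ν g⁻¹ = ν g)
    (h_nonneg : ∀ g : G, 0 ≤ ν g)
    (φ : G) (N : ℕ) (hN : 1 ≤ N) :
    Filter.liminf (fun ℓ : ℕ => ((ν (φ ^ (N * ℓ)) : ℝ) : EReal)) Filter.atTop ≤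
      2 * Filter.liminf (fun k : ℕ => ((ν (φ ^ k) : ℝ) : EReal)) Filter.atTop := by
  have key : ∀ c : ℝ, Filter.liminf (fun k : ℕ => ((ν (φ ^ k) : ℝ) : EReal)) Filter.atTop < c →
      Filter.liminf (fun l : ℕ => ((ν (φ ^ (N * l)) : ℝ) : EReal)) Filter.atTop ≤
        ((c + c : ℝ) : EReal) := by
    intro c hc
    have hfreq : ∃ᶠ k in Filter.atTop, ν (φ ^ k) < c :=
      (Filter.frequently_lt_of_liminf_lt (by isBoundedDefault) hc).mono fun k hk =>
        EReal.coe_lt_coe_iff.1 hk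
    exact Filter.liminf_le_of_frequently_le' <|
      (frequently_pow_mul_lt h_sub h_symm hN hfreq).mono fun l hl => EReal.coe_le_coe_iff.2 hl.le
  have h_zero : 0 ≤ Filter.liminf (fun k : ℕ => ((ν (φ ^ k) : ℝ) : EReal)) Filter.atTop :=
    Filter.le_liminf_of_le (by isBoundedDefault)
      (Filter.Eventually.of_forall fun k => EReal.coe_nonneg.2 (h_nonneg _))
  generalize Filter.liminf (fun k : ℕ => ((ν (φ ^ k) : ℝ) : EReal)) Filter.atTop = L at *
  induction L with
  | bot => simp at h_zero
  | top => simp [EReal.mul_top_of_pos]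
  | coe x =>
    have h_two : (2 : EReal) * x = ((2 * x : ℝ) : EReal) := by norm_cast
    rw [h_two]
    refine EReal.le_of_forall_lt_iff_le.1 fun z hz => ?_
    have hz' : 2 * x < z := EReal.coe_lt_coe_iff.1 hz
    have hkey := key (z / 2) (EReal.coe_lt_coe_iff.2 (by linarith))
    rwa [add_halves] at hkey
end
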